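/- Let u be a classical solution with decay weight b of the Zakharov–Kuznetsov–Burgers problem on the strip S, and set χ = b[π²/B² − 4b − 10b² − (16/9)‖u₀‖²]. Then for every t ≥ 0: ∫_S e^{2bx} u(x,y,t)² dx dy ≤ e^{−χ t} ∫_S e^{2bx} u₀(x,y)² dx dy. -/

import Mathlib

open MeasureTheory Real Set

/-- The mixed partial derivative `∂_x^i ∂_y^j ∂_t^k u` of a function
`u = u(x, y, t)`, evaluated at `(x, y, t)`. -/
noncomputable def pd (i j k : ℕ) (u : ℝ → ℝ → ℝ → ℝ) (x y t : ℝ) : ℝ :=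
  iteratedDeriv i (fun x' => iteratedDeriv j (fun y' => iteratedDeriv k (u x' y') t) y) x

/-- The strip `S = ℝ × (0, B)`. -/
def strip (B : ℝ) : Set (ℝ × ℝ) := Set.univ ×ˢ Set.Ioo 0 B

/-- A classical solution, with decay weight `b`, of the Zakharov–Kuznetsov–Burgers
initial-boundary value problem on the strip `S = ℝ × (0, B)`:
a smooth function `u(x, y, t)` satisfying the ZKB equation
`u_t - u_xx + u u_x + u_xxx + u_xyy = 0` in `ℝ × (0,B) × (0,∞)`, the Dirichlet
boundary conditions `u(x,0,t) = u(x,B,t) = 0`, and such that for every partial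
derivative `∂^α u` of order `|α| ≤ 5` in `x, y, t`, both `|∂^α u|²` and
`e^{2bx} |∂^α u|²` are integrable over `S` for each `t ≥ 0`, with integrals
bounded uniformly for `t` in compact subsets of `[0, ∞)`, and
`(1 + e^{2bx}) |∂^α u(x,y,t)|² → 0` as `|x| → ∞`, uniformly in `y` and locally
uniformly in `t`. -/
structure IsZKBSolution (B b : ℝ) (u : ℝ → ℝ → ℝ → ℝ) : Prop where
  smooth : ContDiff ℝ (⊤ : ℕ∞) (fun p : ℝ × ℝ × ℝ => u p.1 p.2.1 p.2.2)
  pde : ∀ x : ℝ, ∀ y ∈ Set.Ioo (0:ℝ) B, ∀ t : ℝ, 0 < t →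
    pd 0 0 1 u x y t - pd 2 0 0 u x y t + u x y t * pd 1 0 0 u x y t
      + pd 3 0 0 u x y t + pd 1 2 0 u x y t = 0
  bdry0 : ∀ x t : ℝ, 0 ≤ t → u x 0 t = 0
  bdryB : ∀ x t : ℝ, 0 ≤ t → u x B t = 0
  integ : ∀ i j k : ℕ, i + j + k ≤ 5 → ∀ t : ℝ, 0 ≤ t →
    IntegrableOn (fun p : ℝ × ℝ => (1 + Real.exp (2*b*p.1)) * (pd i j k u p.1 p.2 t)^2)
      (strip B) volume
  bdd : ∀ i j k : ℕ, i + j + k ≤ 5 → ∀ T : ℝ, ∃ M : ℝ, ∀ t ∈ Set.Icc (0:ℝ) T,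
    (∫ p in strip B, (1 + Real.exp (2*b*p.1)) * (pd i j k u p.1 p.2 t)^2) ≤ M
  decay : ∀ i j k : ℕ, i + j + k ≤ 5 → ∀ T : ℝ, ∀ ε : ℝ, 0 < ε → ∃ R : ℝ,
    ∀ x : ℝ, R ≤ |x| → ∀ y ∈ Set.Icc (0:ℝ) B, ∀ t ∈ Set.Icc (0:ℝ) T,
      (1 + Real.exp (2*b*x)) * (pd i j k u x y t)^2 ≤ ε


open Filter Topology
open scoped ContDiff

/-! ### Joint smoothness and commutation of partial derivatives -/

theorem ContDiff.partial_fst {E : Type*} [NormedAddCommGroup E] [NormedSpace ℝ E]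
    {F : ℝ × E → ℝ} (hF : ContDiff ℝ ∞ F) :
    ContDiff ℝ ∞ (fun p : ℝ × E => deriv (fun x => F (x, p.2)) p.1) := by
  have h : (fun p : ℝ × E => deriv (fun x => F (x, p.2)) p.1)
      = fun p => fderiv ℝ F p (1, 0) := by
    funext p
    have h1 : HasFDerivAt F (fderiv ℝ F p) (p.1, p.2) :=
      (hF.differentiable (by simp) p).hasFDerivAt
    exact (h1.comp_hasDerivAt p.1 ((hasDerivAt_id p.1).prodMk (hasDerivAt_const p.1 p.2))).deriv
  rw [h]
  exact (hF.fderiv_right (m := ∞) (by simp)).clm_apply contDiff_const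

theorem ContDiff.iteratedPartial_fst {E : Type*} [NormedAddCommGroup E] [NormedSpace ℝ E]
    {F : ℝ × E → ℝ} (hF : ContDiff ℝ ∞ F) (n : ℕ) :
    ContDiff ℝ ∞ (fun p : ℝ × E => iteratedDeriv n (fun x => F (x, p.2)) p.1) := by
  induction n with
  | zero => simpa using hF
  | succ n ih =>
    have := ih.partial_fst
    simpa only [iteratedDeriv_succ] using this

theorem contDiff_pd {u : ℝ → ℝ → ℝ → ℝ}
    (hu : ContDiff ℝ ∞ (fun p : ℝ × ℝ × ℝ => u p.1 p.2.1 p.2.2)) (i j k : ℕ) :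
    ContDiff ℝ ∞ (fun p : ℝ × ℝ × ℝ => pd i j k u p.1 p.2.1 p.2.2) := by
  have ht : ContDiff ℝ ∞ (fun p : ℝ × ℝ × ℝ => iteratedDeriv k (u p.2.1 p.2.2) p.1) :=
    ContDiff.iteratedPartial_fst (F := fun p : ℝ × ℝ × ℝ => u p.2.1 p.2.2 p.1)
      (hu.comp (f := fun p : ℝ × ℝ × ℝ => (p.2.1, p.2.2, p.1)) (by fun_prop)) k
  have hy : ContDiff ℝ ∞ (fun p : ℝ × ℝ × ℝ =>
      iteratedDeriv j (fun y => iteratedDeriv k (u p.2.1 y) p.2.2) p.1) :=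
    ContDiff.iteratedPartial_fst (F := fun p : ℝ × ℝ × ℝ => iteratedDeriv k (u p.2.1 p.1) p.2.2)
      (ht.comp (f := fun p : ℝ × ℝ × ℝ => (p.2.2, p.2.1, p.1)) (by fun_prop)) j
  exact ContDiff.iteratedPartial_fst
    (F := fun p : ℝ × ℝ × ℝ => iteratedDeriv j (fun y => iteratedDeriv k (u p.1 y) p.2.2) p.2.1)
    (hy.comp (f := fun p : ℝ × ℝ × ℝ => (p.2.1, p.1, p.2.2)) (by fun_prop)) i

theorem hasDerivAt_pd_x {u : ℝ → ℝ → ℝ → ℝ}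
    (hu : ContDiff ℝ ∞ (fun p : ℝ × ℝ × ℝ => u p.1 p.2.1 p.2.2)) (i j k : ℕ) (x y t : ℝ) :
    HasDerivAt (fun x' => pd i j k u x' y t) (pd (i + 1) j k u x y t) x := by
  have h : DifferentiableAt ℝ (fun x' => pd i j k u x' y t) x :=
    (((contDiff_pd hu i j k).comp (f := fun x' : ℝ => (x', y, t)) (by fun_prop)).differentiable
      (by simp)) x
  have h2 := h.hasDerivAt
  unfold pd at h2 ⊢
  rwa [iteratedDeriv_succ]

theorem hasDerivAt_pd_y {u : ℝ → ℝ → ℝ → ℝ}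
    (hu : ContDiff ℝ ∞ (fun p : ℝ × ℝ × ℝ => u p.1 p.2.1 p.2.2)) (j k : ℕ) (x y t : ℝ) :
    HasDerivAt (fun y' => pd 0 j k u x y' t) (pd 0 (j + 1) k u x y t) y := by
  have h : DifferentiableAt ℝ (fun y' => pd 0 j k u x y' t) y :=
    (((contDiff_pd hu 0 j k).comp (f := fun y' : ℝ => (x, y', t)) (by fun_prop)).differentiable
      (by simp)) y
  have h2 := h.hasDerivAt
  simp only [pd, iteratedDeriv_zero] at h2 ⊢
  rwa [iteratedDeriv_succ]

theorem hasDerivAt_pd_t {u : ℝ → ℝ → ℝ → ℝ}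
    (hu : ContDiff ℝ ∞ (fun p : ℝ × ℝ × ℝ => u p.1 p.2.1 p.2.2)) (k : ℕ) (x y t : ℝ) :
    HasDerivAt (fun t' => pd 0 0 k u x y t') (pd 0 0 (k + 1) u x y t) t := by
  have h : DifferentiableAt ℝ (fun t' => pd 0 0 k u x y t') t :=
    (((contDiff_pd hu 0 0 k).comp (f := fun t' : ℝ => (x, y, t')) (by fun_prop)).differentiable
      (by simp)) t
  have h2 := h.hasDerivAt
  simp only [pd, iteratedDeriv_zero] at h2 ⊢
  rwa [iteratedDeriv_succ]

theorem hasDerivAt_deriv_comm {g : ℝ × ℝ → ℝ} (hg : ContDiff ℝ ∞ g) (x y : ℝ) :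
    HasDerivAt (fun y' => deriv (fun x' => g (x', y')) x)
      (deriv (fun x' => deriv (fun y' => g (x', y')) y) x) y := by
  have hd : Differentiable ℝ g := hg.differentiable (by simp)
  have hd2 : Differentiable ℝ (fderiv ℝ g) :=
    (hg.fderiv_right (m := ∞) (by simp)).differentiable (by simp)
  have hfst : ∀ x y, HasDerivAt (fun x' => ((x', y) : ℝ × ℝ)) (1, 0) x := fun x y =>
    (hasDerivAt_id x).prodMk (hasDerivAt_const x y)
  have hsnd : ∀ x y, HasDerivAt (fun y' => ((x, y') : ℝ × ℝ)) (0, 1) y := fun x y =>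
    (hasDerivAt_const y x).prodMk (hasDerivAt_id y)
  have e1 : (fun y' => deriv (fun x' => g (x', y')) x) = fun y' => fderiv ℝ g (x, y') (1, 0) :=
    funext fun y' => ((hd (x, y')).hasFDerivAt.comp_hasDerivAt x (hfst x y')).deriv
  have e2 : (fun x' => deriv (fun y' => g (x', y')) y) = fun x' => fderiv ℝ g (x', y) (0, 1) :=
    funext fun x' => ((hd (x', y)).hasFDerivAt.comp_hasDerivAt y (hsnd x' y)).deriv
  have h2 : HasDerivAt (fun y' => fderiv ℝ g (x, y')) (fderiv ℝ (fderiv ℝ g) (x, y) (0, 1)) y :=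
    (hd2 (x, y)).hasFDerivAt.comp_hasDerivAt y (hsnd x y)
  have h3 : HasDerivAt (fun x' => fderiv ℝ g (x', y)) (fderiv ℝ (fderiv ℝ g) (x, y) (1, 0)) x :=
    (hd2 (x, y)).hasFDerivAt.comp_hasDerivAt x (hfst x y)
  have h4 : HasDerivAt (fun x' => fderiv ℝ g (x', y) (0, 1))
      (fderiv ℝ (fderiv ℝ g) (x, y) (1, 0) (0, 1)) x := by
    simpa using h3.clm_apply (hasDerivAt_const x ((0, 1) : ℝ × ℝ))
  have hsym : IsSymmSndFDerivAt ℝ g (x, y) :=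
    hg.contDiffAt.isSymmSndFDerivAt
      (by simpa using WithTop.coe_le_coe.2 (le_top (a := (2 : ℕ∞))))
  rw [e1, e2, h4.deriv, hsym.eq (1, 0) (0, 1)]
  simpa using h2.clm_apply (hasDerivAt_const y ((1, 0) : ℝ × ℝ))

theorem hasDerivAt_pd_one_y {u : ℝ → ℝ → ℝ → ℝ}
    (hu : ContDiff ℝ ∞ (fun p : ℝ × ℝ × ℝ => u p.1 p.2.1 p.2.2)) (j k : ℕ) (x y t : ℝ) :
    HasDerivAt (fun y' => pd 1 j k u x y' t) (pd 1 (j + 1) k u x y t) y := by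
  have h := hasDerivAt_deriv_comm
    ((contDiff_pd hu 0 j k).comp (f := fun p : ℝ × ℝ => (p.1, p.2, t)) (by fun_prop)) x y
  have e : (fun x' => deriv (fun y' => pd 0 j k u x' y' t) y) = fun x' => pd 0 (j + 1) k u x' y t :=
    funext fun x' => (hasDerivAt_pd_y hu j k x' y t).deriv
  simp only [Function.comp_def] at h
  rw [e] at h
  simpa only [pd, iteratedDeriv_zero, iteratedDeriv_one] using h

/-! ### The Steklov inequality -/

theorem continuousAt_sq_div_of_hasDerivAt {f s : ℝ → ℝ} {f' s' a : ℝ} (hf : HasDerivAt f f' a)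
    (hs : HasDerivAt s s' a) (hfa : f a = 0) (hsa : s a = 0) (hs' : s' ≠ 0) :
    ContinuousAt (fun y => f y ^ 2 / s y) a := by
  have h1 := hasDerivAt_iff_tendsto_slope.1 hf
  have h2 := hasDerivAt_iff_tendsto_slope.1 hs
  have h3 : Tendsto (fun y => f y * (slope f a y / slope s a y)) (𝓝[≠] a) (𝓝 (0 * (f' / s'))) := by
    refine Tendsto.mul ?_ (h1.div h2 hs')
    rw [← hfa]
    exact hf.continuousAt.tendsto.mono_left nhdsWithin_le_nhds
  rw [continuousAt_iff_punctured_nhds]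
  simp only [hsa, div_zero]
  rw [zero_mul] at h3
  refine h3.congr' ?_
  filter_upwards [self_mem_nhdsWithin] with y hy
  have hy' : y - a ≠ 0 := sub_ne_zero.2 hy
  rw [slope_def_field, slope_def_field, hfa, hsa, sub_zero, sub_zero, div_div_div_cancel_right₀ hy']
  ring

theorem steklov_interval {B : ℝ} (hB : 0 < B) {f f' : ℝ → ℝ}
    (hf : ∀ y, HasDerivAt f (f' y) y) (hf' : Continuous f') (h0 : f 0 = 0) (hfB : f B = 0) :
    π ^ 2 / B ^ 2 * ∫ y in Ioo 0 B, f y ^ 2 ≤ ∫ y in Ioo 0 B, f' y ^ 2 := by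
  set k : ℝ := π / B with hk
  have hkB : k * B = π := by rw [hk]; field_simp
  have hkpos : 0 < k := by positivity
  have hfc : Continuous f := continuous_iff_continuousAt.2 fun y => (hf y).continuousAt
  have hs : ∀ y, HasDerivAt (fun y => sin (k * y)) (cos (k * y) * k) y := fun y => by
    simpa using (((hasDerivAt_id y).const_mul k).sin)
  have hc : ∀ y, HasDerivAt (fun y => cos (k * y)) (-sin (k * y) * k) y := fun y => by
    simpa using (((hasDerivAt_id y).const_mul k).cos)
  have hspos : ∀ y ∈ Ioo 0 B, 0 < sin (k * y) := fun y hy =>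
    sin_pos_of_pos_of_lt_pi (mul_pos hkpos hy.1) (by rw [← hkB]; gcongr; exact hy.2)
  have hcont : ContinuousOn (fun y => k * cos (k * y) * (f y ^ 2 / sin (k * y))) (Icc 0 B) := by
    intro y hy
    refine ContinuousAt.continuousWithinAt (ContinuousAt.mul (by fun_prop) ?_)
    rcases eq_or_lt_of_le hy.1 with rfl | hy0
    · exact continuousAt_sq_div_of_hasDerivAt (hf 0) (hs 0) h0 (by simp) (by simp [hkpos.ne'])
    rcases eq_or_lt_of_le hy.2 with rfl | hyB
    · exact continuousAt_sq_div_of_hasDerivAt (hf y) (hs y) hfB (by simp [hkB])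
        (by simp [hkB, hkpos.ne'])
    · exact ContinuousAt.div (by fun_prop) (by fun_prop) (hspos y ⟨hy0, hyB⟩).ne'
  have key := intervalIntegral.sub_le_integral_of_hasDeriv_right_of_le hB.le hcont
    (g' := fun y => (-k ^ 2 * sin (k * y)) * (f y ^ 2 / sin (k * y)) + k * cos (k * y) *
      ((2 * f y * f' y * sin (k * y) - f y ^ 2 * (cos (k * y) * k)) / sin (k * y) ^ 2))
    (φ := fun y => f' y ^ 2 - k ^ 2 * f y ^ 2)
    (fun y hy => by
      have h1 := ((hc y).const_mul k).mul (((hf y).pow 2).div (hs y) (hspos y hy).ne')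
      refine (h1.congr_deriv ?_).hasDerivWithinAt
      simp only [Pi.div_apply, Pi.pow_apply, Nat.cast_ofNat, Nat.add_one_sub_one, pow_one]
      ring)
    ((by fun_prop : Continuous fun y => f' y ^ 2 - k ^ 2 * f y ^ 2).integrableOn_Icc)
    (fun y hy => by
      have hp := (hspos y hy).ne'
      have : f' y ^ 2 - k ^ 2 * f y ^ 2 - ((-k ^ 2 * sin (k * y)) * (f y ^ 2 / sin (k * y))
          + k * cos (k * y) * ((2 * f y * f' y * sin (k * y) - f y ^ 2 * (cos (k * y) * k))
            / sin (k * y) ^ 2)) = (f' y - k * cos (k * y) * f y / sin (k * y)) ^ 2 := by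
        field_simp
        ring
      have h2 := sq_nonneg (f' y - k * cos (k * y) * f y / sin (k * y))
      linarith)
  rw [intervalIntegral.integral_of_le hB.le, integral_Ioc_eq_integral_Ioo, integral_sub,
    integral_const_mul] at key
  · simp only [h0, hfB, hk, div_pow] at key ⊢
    simp at key
    exact key
  · exact ((by fun_prop : Continuous fun y => f' y ^ 2).integrableOn_Icc).mono_set
      Ioo_subset_Icc_self
  · exact ((by fun_prop : Continuous fun y => k ^ 2 * f y ^ 2).integrableOn_Icc).mono_set
      Ioo_subset_Icc_self

/-! ### Functions on the strip with weighted decay -/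

/-- A continuous function which, together with its product with `e^{bx}`, is square integrable
on the strip and tends to zero as `|x| → ∞`, uniformly in `y`. -/
structure DecaysOnStrip (B b : ℝ) (f : ℝ → ℝ → ℝ) : Prop where
  cont : Continuous (fun p : ℝ × ℝ => f p.1 p.2)
  integ : IntegrableOn (fun p : ℝ × ℝ => (1 + exp (2 * b * p.1)) * f p.1 p.2 ^ 2) (strip B)
  decay : ∀ ε : ℝ, 0 < ε → ∃ R : ℝ, ∀ x : ℝ, R ≤ |x| → ∀ y ∈ Icc (0 : ℝ) B,
    (1 + exp (2 * b * x)) * f x y ^ 2 ≤ ε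

theorem IsZKBSolution.decaysOnStrip {B b : ℝ} {u : ℝ → ℝ → ℝ → ℝ} (hu : IsZKBSolution B b u)
    {i j k : ℕ} (h : i + j + k ≤ 5) {t : ℝ} (ht : 0 ≤ t) :
    DecaysOnStrip B b (fun x y => pd i j k u x y t) where
  cont := ((contDiff_pd hu.smooth i j k).comp (f := fun p : ℝ × ℝ => (p.1, p.2, t))
    (by fun_prop)).continuous
  integ := hu.integ i j k h t ht
  decay ε hε := by
    obtain ⟨R, hR⟩ := hu.decay i j k h t ε hε
    exact ⟨R, fun x hx y hy => hR x hx y hy t ⟨ht, le_rfl⟩⟩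

theorem measurableSet_strip (B : ℝ) : MeasurableSet (strip B) :=
  MeasurableSet.univ.prod measurableSet_Ioo

theorem volume_restrict_strip (B : ℝ) :
    (volume : Measure (ℝ × ℝ)).restrict (strip B)
      = (volume : Measure ℝ).prod (volume.restrict (Ioo 0 B)) := by
  rw [strip, Measure.volume_eq_prod, ← Measure.prod_restrict, Measure.restrict_univ]

theorem exp_le_one_add_exp {b c : ℝ} (hc : 0 ≤ c) (hcb : c ≤ b) (x : ℝ) :
    exp (2 * c * x) ≤ 1 + exp (2 * b * x) := by
  rcases le_total x 0 with hx | hx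
  · have : exp (2 * c * x) ≤ 1 := exp_le_one_iff.2 (by nlinarith)
    linarith [exp_pos (2 * b * x)]
  · have : exp (2 * c * x) ≤ exp (2 * b * x) := exp_le_exp.2 (by nlinarith)
    linarith

theorem abs_exp_mul_mul_le {b c : ℝ} (hc : 0 ≤ c) (hcb : c ≤ b) (x r s : ℝ) :
    |exp (2 * c * x) * (r * s)|
      ≤ (1 + exp (2 * b * x)) * r ^ 2 + (1 + exp (2 * b * x)) * s ^ 2 := by
  have h1 := exp_le_one_add_exp hc hcb x
  have h2 : |r * s| ≤ r ^ 2 + s ^ 2 := by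
    rw [abs_le]; constructor <;> nlinarith [sq_nonneg (r + s), sq_nonneg (r - s)]
  rw [abs_mul, abs_of_pos (exp_pos _), ← mul_add]
  exact mul_le_mul h1 h2 (abs_nonneg _) (by positivity)

namespace DecaysOnStrip

variable {B b c : ℝ} {f g : ℝ → ℝ → ℝ}

theorem integrableOn_mul (hf : DecaysOnStrip B b f) (hg : DecaysOnStrip B b g)
    (hc : 0 ≤ c) (hcb : c ≤ b) :
    IntegrableOn (fun p : ℝ × ℝ => exp (2 * c * p.1) * (f p.1 p.2 * g p.1 p.2)) (strip B) := by
  have hfc := hf.cont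
  have hgc := hg.cont
  refine Integrable.mono' (hf.integ.add hg.integ)
    (by fun_prop : Continuous fun p : ℝ × ℝ =>
      exp (2 * c * p.1) * (f p.1 p.2 * g p.1 p.2)).aestronglyMeasurable
    (Eventually.of_forall fun p => ?_)
  exact abs_exp_mul_mul_le hc hcb p.1 _ _

theorem integrableOn_sq (hf : DecaysOnStrip B b f) (hc : 0 ≤ c) (hcb : c ≤ b) :
    IntegrableOn (fun p : ℝ × ℝ => exp (2 * c * p.1) * f p.1 p.2 ^ 2) (strip B) := by
  simpa only [sq] using hf.integrableOn_mul hf hc hcb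

theorem tendsto_weight_sq (hf : DecaysOnStrip B b f) {y : ℝ} (hy : y ∈ Icc 0 B) :
    Tendsto (fun x => (1 + exp (2 * b * x)) * f x y ^ 2) (cocompact ℝ) (𝓝 0) := by
  rw [Metric.tendsto_nhds]
  intro ε hε
  obtain ⟨R, hR⟩ := hf.decay (ε / 2) (by positivity)
  have h : ∀ᶠ x in cocompact ℝ, R ≤ ‖x‖ := tendsto_norm_cocompact_atTop.eventually_ge_atTop R
  filter_upwards [h] with x hx
  have := hR x hx y hy
  rw [dist_zero_right, norm_eq_abs, abs_of_nonneg (by positivity)]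
  linarith

theorem tendsto_mul (hf : DecaysOnStrip B b f) (hg : DecaysOnStrip B b g)
    (hc : 0 ≤ c) (hcb : c ≤ b) {y : ℝ} (hy : y ∈ Icc 0 B) :
    Tendsto (fun x => exp (2 * c * x) * (f x y * g x y)) (cocompact ℝ) (𝓝 0) := by
  refine squeeze_zero_norm (fun x => abs_exp_mul_mul_le hc hcb x _ _) ?_
  simpa using (hf.tendsto_weight_sq hy).add (hg.tendsto_weight_sq hy)

theorem tendsto_sq (hf : DecaysOnStrip B b f) (hc : 0 ≤ c) (hcb : c ≤ b)
    {y : ℝ} (hy : y ∈ Icc 0 B) :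
    Tendsto (fun x => exp (2 * c * x) * f x y ^ 2) (cocompact ℝ) (𝓝 0) := by
  simpa only [sq] using hf.tendsto_mul hf hc hcb hy

theorem bounded (hf : DecaysOnStrip B b f) :
    ∃ K : ℝ, ∀ x : ℝ, ∀ y ∈ Icc 0 B, |f x y| ≤ K := by
  obtain ⟨R, hR⟩ := hf.decay 1 one_pos
  obtain ⟨K, hK⟩ := ((isCompact_Icc (a := -R) (b := R)).prod
    (isCompact_Icc (a := (0 : ℝ)) (b := B))).exists_bound_of_continuousOn hf.cont.continuousOn
  refine ⟨max K 1, fun x y hy => ?_⟩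
  rcases le_total R |x| with hx | hx
  · refine le_max_of_le_right (abs_le_one_iff_mul_self_le_one.2 ?_)
    nlinarith [hR x hx y hy, exp_pos (2 * b * x), sq_nonneg (f x y),
      mul_nonneg (exp_pos (2 * b * x)).le (sq_nonneg (f x y))]
  · exact le_max_of_le_left (hK (x, y) ⟨abs_le.1 hx, hy⟩)

theorem integrableOn_mul_mul {h : ℝ → ℝ → ℝ} (hf : DecaysOnStrip B b f) (hg : DecaysOnStrip B b g)
    (hh : DecaysOnStrip B b h) (hc : 0 ≤ c) (hcb : c ≤ b) :
    IntegrableOn (fun p : ℝ × ℝ => exp (2 * c * p.1) * (f p.1 p.2 * g p.1 p.2) * h p.1 p.2)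
      (strip B) := by
  obtain ⟨K, hK⟩ := hh.bounded
  refine Integrable.mul_bdd (c := K) (hf.integrableOn_mul hg hc hcb)
    hh.cont.aestronglyMeasurable ?_
  filter_upwards [ae_restrict_mem (measurableSet_strip B)] with p hp
  exact hK p.1 p.2 (Ioo_subset_Icc_self hp.2)

theorem tendsto_mul_mul {h : ℝ → ℝ → ℝ} (hf : DecaysOnStrip B b f) (hg : DecaysOnStrip B b g)
    (hh : DecaysOnStrip B b h) (hc : 0 ≤ c) (hcb : c ≤ b) {y : ℝ} (hy : y ∈ Icc 0 B) :
    Tendsto (fun x => exp (2 * c * x) * (f x y * g x y) * h x y) (cocompact ℝ) (𝓝 0) := by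
  obtain ⟨K, hK⟩ := hh.bounded
  refine squeeze_zero_norm (a := fun x => |exp (2 * c * x) * (f x y * g x y)| * K) (fun x => ?_) ?_
  · rw [norm_mul, norm_eq_abs, norm_eq_abs]
    exact mul_le_mul_of_nonneg_left (hK x y hy) (abs_nonneg _)
  · simpa using ((hf.tendsto_mul hg hc hcb hy).abs).mul_const K

theorem add (hf : DecaysOnStrip B b f) (hg : DecaysOnStrip B b g) :
    DecaysOnStrip B b (fun x y => f x y + g x y) := by
  have key : ∀ x y, (1 + exp (2 * b * x)) * (f x y + g x y) ^ 2
      ≤ 2 * ((1 + exp (2 * b * x)) * f x y ^ 2) + 2 * ((1 + exp (2 * b * x)) * g x y ^ 2) := by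
    intro x y
    have h : (f x y + g x y) ^ 2 ≤ 2 * f x y ^ 2 + 2 * g x y ^ 2 := by
      nlinarith [sq_nonneg (f x y - g x y)]
    have := mul_le_mul_of_nonneg_left h (by positivity : 0 ≤ 1 + exp (2 * b * x))
    linarith
  have hfc := hf.cont
  have hgc := hg.cont
  refine ⟨by fun_prop, ?_, fun ε hε => ?_⟩
  · refine Integrable.mono' ((hf.integ.const_mul 2).add (hg.integ.const_mul 2))
      (by fun_prop : Continuous fun p : ℝ × ℝ =>
        (1 + exp (2 * b * p.1)) * (f p.1 p.2 + g p.1 p.2) ^ 2).aestronglyMeasurable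
      (Eventually.of_forall fun p => ?_)
    rw [norm_eq_abs, abs_of_nonneg (by positivity)]
    exact key p.1 p.2
  · obtain ⟨R, hR⟩ := hf.decay (ε / 4) (by positivity)
    obtain ⟨R', hR'⟩ := hg.decay (ε / 4) (by positivity)
    refine ⟨max R R', fun x hx y hy => (key x y).trans ?_⟩
    have := hR x (le_of_max_le_left hx) y hy
    have := hR' x (le_of_max_le_right hx) y hy
    linarith

theorem const_mul (hf : DecaysOnStrip B b f) (a : ℝ) :
    DecaysOnStrip B b (fun x y => a * f x y) := by
  have hfc := hf.cont
  have e : ∀ x y, (1 + exp (2 * b * x)) * (a * f x y) ^ 2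
      = a ^ 2 * ((1 + exp (2 * b * x)) * f x y ^ 2) := fun x y => by ring
  refine ⟨by fun_prop, ?_, fun ε hε => ?_⟩
  · simp only [e]
    exact hf.integ.const_mul _
  · obtain ⟨R, hR⟩ := hf.decay (ε / (a ^ 2 + 1)) (by positivity)
    refine ⟨R, fun x hx y hy => ?_⟩
    rw [e]
    have h1 := hR x hx y hy
    rw [le_div_iff₀ (by positivity)] at h1
    have h2 : 0 ≤ (1 + exp (2 * b * x)) * f x y ^ 2 := by positivity
    linarith

end DecaysOnStrip

/-! ### Divergence theorems and functional inequalities on the strip -/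

theorem integral_strip_deriv_x_eq_zero {B : ℝ} {P P' : ℝ → ℝ → ℝ}
    (hP : ∀ x y, HasDerivAt (fun x' => P x' y) (P' x y) x)
    (hint : IntegrableOn (fun p : ℝ × ℝ => P' p.1 p.2) (strip B))
    (hlim : ∀ y ∈ Icc 0 B, Tendsto (fun x => P x y) (cocompact ℝ) (𝓝 0)) :
    ∫ p in strip B, P' p.1 p.2 = 0 := by
  rw [IntegrableOn, volume_restrict_strip] at hint
  rw [volume_restrict_strip, integral_prod_symm _ hint]
  refine integral_eq_zero_of_ae ?_
  filter_upwards [ae_restrict_mem measurableSet_Ioo, hint.prod_left_ae] with y hy hy2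
  have hl := hlim y (Ioo_subset_Icc_self hy)
  simpa using integral_of_hasDerivAt_of_tendsto (fun x => hP x y) hy2
    (hl.mono_left atBot_le_cocompact) (hl.mono_left atTop_le_cocompact)

theorem integral_strip_deriv_y_eq_zero {B : ℝ} (hB : 0 < B) {Q Q' : ℝ → ℝ → ℝ}
    (hQ : ∀ x y, HasDerivAt (fun y' => Q x y') (Q' x y) y)
    (hc : Continuous (fun p : ℝ × ℝ => Q' p.1 p.2))
    (hint : IntegrableOn (fun p : ℝ × ℝ => Q' p.1 p.2) (strip B))
    (h0 : ∀ x, Q x 0 = 0) (hQB : ∀ x, Q x B = 0) :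
    ∫ p in strip B, Q' p.1 p.2 = 0 := by
  rw [IntegrableOn, volume_restrict_strip] at hint
  rw [volume_restrict_strip, integral_prod _ hint]
  refine integral_eq_zero_of_ae (Eventually.of_forall fun x => ?_)
  have hcx : Continuous (fun y => Q' x y) :=
    hc.comp (f := fun y : ℝ => (x, y)) (by fun_prop)
  have h := intervalIntegral.integral_eq_sub_of_hasDerivAt (a := 0) (b := B)
    (fun y _ => hQ x y) (hcx.intervalIntegrable 0 B)
  rw [intervalIntegral.integral_of_le hB.le, integral_Ioc_eq_integral_Ioo, h0, hQB, sub_zero] at h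
  exact h

theorem steklov_strip {B b c : ℝ} (hB : 0 < B) (hc : 0 ≤ c) (hcb : c ≤ b) {f f' : ℝ → ℝ → ℝ}
    (hf : DecaysOnStrip B b f) (hf' : DecaysOnStrip B b f')
    (hd : ∀ x y, HasDerivAt (fun y' => f x y') (f' x y) y)
    (h0 : ∀ x, f x 0 = 0) (hfB : ∀ x, f x B = 0) :
    π ^ 2 / B ^ 2 * ∫ p in strip B, exp (2 * c * p.1) * f p.1 p.2 ^ 2
      ≤ ∫ p in strip B, exp (2 * c * p.1) * f' p.1 p.2 ^ 2 := by
  have h1 := hf.integrableOn_sq hc hcb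
  have h2 := hf'.integrableOn_sq hc hcb
  rw [IntegrableOn, volume_restrict_strip] at h1 h2
  rw [volume_restrict_strip, integral_prod _ h1, integral_prod _ h2, ← integral_const_mul]
  refine integral_mono (h1.integral_prod_left.const_mul _) h2.integral_prod_left fun x => ?_
  have hcx : Continuous (fun y => f' x y) := hf'.cont.comp (f := fun y : ℝ => (x, y)) (by fun_prop)
  have := mul_le_mul_of_nonneg_left (steklov_interval hB (hd x) hcx (h0 x) (hfB x))
    (exp_pos (2 * c * x)).le
  simp only [integral_const_mul]
  linarith

theorem sq_integral_abs_mul_le {α : Type*} [MeasurableSpace α] {μ : Measure α} {r s w : α → ℝ}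
    (hw : ∀ a, 0 ≤ w a) (hrr : Integrable (fun a => w a * r a ^ 2) μ)
    (hss : Integrable (fun a => w a * s a ^ 2) μ)
    (hrs : Integrable (fun a => w a * (r a * s a)) μ) :
    (∫ a, |w a * (r a * s a)| ∂μ) ^ 2
      ≤ (∫ a, w a * r a ^ 2 ∂μ) * ∫ a, w a * s a ^ 2 ∂μ := by
  have key : ∀ k : ℝ, 0 ≤ (∫ a, w a * r a ^ 2 ∂μ) * (k * k)
      + (-2 * ∫ a, |w a * (r a * s a)| ∂μ) * k + ∫ a, w a * s a ^ 2 ∂μ := by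
    intro k
    have h : 0 ≤ ∫ a, (k * k * (w a * r a ^ 2) + (-2 * k) * |w a * (r a * s a)|)
        + w a * s a ^ 2 ∂μ := by
      refine integral_nonneg fun a => ?_
      have e : |w a * (r a * s a)| = w a * (|r a| * |s a|) := by
        rw [abs_mul, abs_mul, abs_of_nonneg (hw a)]
      have : 0 ≤ w a * (k * |r a| - |s a|) ^ 2 := mul_nonneg (hw a) (sq_nonneg _)
      simp only [Pi.zero_apply, e]
      rw [← sq_abs (r a), ← sq_abs (s a)]
      linarith
    have hi1 : Integrable (fun a => k * k * (w a * r a ^ 2)) μ := hrr.const_mul _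
    have hi2 : Integrable (fun a => (-2 * k) * |w a * (r a * s a)|) μ := hrs.abs.const_mul _
    rw [integral_add (hi1.fun_add hi2) hss, integral_add hi1 hi2, integral_const_mul,
      integral_const_mul] at h
    linarith
  have := discrim_le_zero key
  rw [discrim] at this
  linarith

theorem hasDerivAt_exp_weight (c x : ℝ) :
    HasDerivAt (fun x' => exp (2 * c * x')) (2 * c * exp (2 * c * x)) x := by
  simpa [mul_comm] using ((hasDerivAt_id x).const_mul (2 * c)).exp

/-- A weighted Ladyzhenskaya inequality on the strip. -/
theorem ladyzhenskaya_strip {B b : ℝ} (hb : 0 ≤ b) {f fx fy : ℝ → ℝ → ℝ}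
    (hf : DecaysOnStrip B b f) (hfx : DecaysOnStrip B b fx) (hfy : DecaysOnStrip B b fy)
    (hdx : ∀ x y, HasDerivAt (fun x' => f x' y) (fx x y) x)
    (hdy : ∀ x y, HasDerivAt (fun y' => f x y') (fy x y) y) (h0 : ∀ x, f x 0 = 0) :
    IntegrableOn (fun p : ℝ × ℝ => (exp (2 * b * p.1) * f p.1 p.2 ^ 2) ^ 2) (strip B) ∧
    ∫ p in strip B, (exp (2 * b * p.1) * f p.1 p.2 ^ 2) ^ 2
      ≤ 2 * (∫ p in strip B, exp (2 * b * p.1) * f p.1 p.2 ^ 2) *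
        ((∫ p in strip B, exp (2 * b * p.1) * (fx p.1 p.2 + b * f p.1 p.2) ^ 2)
          + ∫ p in strip B, exp (2 * b * p.1) * fy p.1 p.2 ^ 2) := by
  have hg := hfx.add (hf.const_mul b)
  have hfc := hf.cont
  have hcs1 := sq_integral_abs_mul_le (w := fun p : ℝ × ℝ => exp (2 * b * p.1))
    (fun p => (exp_pos _).le) (hf.integrableOn_sq hb le_rfl) (hg.integrableOn_sq hb le_rfl)
    (hf.integrableOn_mul hg hb le_rfl)
  have hcs2 := sq_integral_abs_mul_le (w := fun p : ℝ × ℝ => exp (2 * b * p.1))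
    (fun p => (exp_pos _).le) (hf.integrableOn_sq hb le_rfl) (hfy.integrableOn_sq hb le_rfl)
    (hf.integrableOn_mul hfy hb le_rfl)
  have hgi := (hf.integrableOn_mul hg hb le_rfl).abs
  have hhi := (hf.integrableOn_mul hfy hb le_rfl).abs
  have hE : 0 ≤ ∫ p in strip B, exp (2 * b * p.1) * f p.1 p.2 ^ 2 :=
    integral_nonneg fun p => by positivity
  have hgi' := hf.integrableOn_mul hg hb le_rfl
  rw [IntegrableOn] at hgi'
  rw [volume_restrict_strip] at hgi hhi hgi'
  have hdxw : ∀ x y, HasDerivAt (fun x' => exp (2 * b * x') * f x' y ^ 2)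
      (2 * (exp (2 * b * x) * (f x y * (fx x y + b * f x y)))) x := fun x y =>
    ((hasDerivAt_exp_weight b x).mul ((hdx x y).pow 2)).congr_deriv (by simp; ring)
  have hdyw : ∀ x y, HasDerivAt (fun y' => exp (2 * b * x) * f x y' ^ 2)
      (2 * (exp (2 * b * x) * (f x y * fy x y))) y := fun x y =>
    (((hdy x y).pow 2).const_mul _).congr_deriv (by simp; ring)
  set A : ℝ → ℝ := fun y => ∫ x, |exp (2 * b * x) * (f x y * (fx x y + b * f x y))| with hA
  set C : ℝ → ℝ := fun x => ∫ y in Ioo 0 B, |exp (2 * b * x) * (f x y * fy x y)| with hC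
  have hAint : Integrable A (volume.restrict (Ioo 0 B)) := hgi.integral_prod_right
  have hCint : Integrable C := hhi.integral_prod_left
  have hAle : ∀ᵐ y ∂(volume.restrict (Ioo 0 B)), ∀ x, exp (2 * b * x) * f x y ^ 2 ≤ 2 * A y := by
    filter_upwards [ae_restrict_mem measurableSet_Ioo, hgi.prod_left_ae,
      hgi'.prod_left_ae] with y hy hy1 hy2 x
    have h1 := integral_Iic_of_hasDerivAt_of_tendsto' (a := x) (fun x' _ => hdxw x' y)
      (hy2.const_mul 2).integrableOn
      ((hf.tendsto_sq hb le_rfl (Ioo_subset_Icc_self hy)).mono_left atBot_le_cocompact)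
    rw [sub_zero] at h1
    rw [← h1, hA, ← integral_const_mul]
    calc _ ≤ ∫ x' in Iic x, 2 * |exp (2 * b * x') * (f x' y * (fx x' y + b * f x' y))| :=
          integral_mono (hy2.const_mul 2).integrableOn (hy1.const_mul 2).integrableOn
            fun x' => mul_le_mul_of_nonneg_left (le_abs_self _) two_pos.le
      _ ≤ _ := setIntegral_le_integral (hy1.const_mul 2)
          (Eventually.of_forall fun x' => by positivity)
  have hCle : ∀ x, ∀ y ∈ Ioo 0 B, exp (2 * b * x) * f x y ^ 2 ≤ 2 * C x := by
    intro x y hy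
    have hcont : Continuous (fun y' => exp (2 * b * x) * (f x y' * fy x y')) := by
      have h1 : Continuous (fun y' => f x y') :=
        hf.cont.comp (f := fun y' : ℝ => (x, y')) (by fun_prop)
      have h2 : Continuous (fun y' => fy x y') :=
        hfy.cont.comp (f := fun y' : ℝ => (x, y')) (by fun_prop)
      fun_prop
    have h1 := intervalIntegral.integral_eq_sub_of_hasDerivAt (a := 0) (b := y)
      (fun y' _ => hdyw x y') ((hcont.const_mul 2).intervalIntegrable 0 y)
    rw [h0, intervalIntegral.integral_of_le hy.1.le] at h1
    have h2 : exp (2 * b * x) * f x y ^ 2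
        = ∫ y' in Ioc 0 y, 2 * (exp (2 * b * x) * (f x y' * fy x y')) := by rw [h1]; simp
    rw [h2, hC, ← integral_const_mul]
    have hI : ∀ s ⊆ Icc 0 B, IntegrableOn
        (fun y' => 2 * |exp (2 * b * x) * (f x y' * fy x y')|) s := fun s hs =>
      (hcont.abs.const_mul 2).integrableOn_Icc.mono_set hs
    have hsub : Ioc 0 y ⊆ Ioo 0 B := fun z hz => ⟨hz.1, hz.2.trans_lt hy.2⟩
    calc _ ≤ ∫ y' in Ioc 0 y, 2 * |exp (2 * b * x) * (f x y' * fy x y')| :=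
          integral_mono ((hcont.const_mul 2).integrableOn_Icc.mono_set Ioc_subset_Icc_self)
            (hI _ (hsub.trans Ioo_subset_Icc_self))
            fun x' => mul_le_mul_of_nonneg_left (le_abs_self _) two_pos.le
      _ ≤ _ := setIntegral_mono_set (hI _ Ioo_subset_Icc_self)
          (Eventually.of_forall fun x' => by positivity) hsub.eventuallyLE
  have hle : ∀ᵐ p ∂((volume : Measure ℝ).prod (volume.restrict (Ioo 0 B))),
      (exp (2 * b * p.1) * f p.1 p.2 ^ 2) ^ 2 ≤ 4 * (C p.1 * A p.2) := by
    filter_upwards [Measure.quasiMeasurePreserving_snd.ae hAle,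
      Measure.quasiMeasurePreserving_snd.ae (ae_restrict_mem measurableSet_Ioo)] with p h1 h2
    have h3 : 0 ≤ exp (2 * b * p.1) * f p.1 p.2 ^ 2 := by positivity
    have h4 := hCle p.1 p.2 h2
    have := mul_le_mul h4 (h1 p.1) h3 (h3.trans h4)
    linarith
  have hCA : Integrable (fun p : ℝ × ℝ => 4 * (C p.1 * A p.2))
      ((volume : Measure ℝ).prod (volume.restrict (Ioo 0 B))) :=
    (hCint.mul_prod hAint).const_mul 4
  have hint : Integrable (fun p : ℝ × ℝ => (exp (2 * b * p.1) * f p.1 p.2 ^ 2) ^ 2)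
      ((volume : Measure ℝ).prod (volume.restrict (Ioo 0 B))) := by
    refine hCA.mono' (by fun_prop : Continuous fun p : ℝ × ℝ =>
      (exp (2 * b * p.1) * f p.1 p.2 ^ 2) ^ 2).aestronglyMeasurable ?_
    filter_upwards [hle] with p hp
    rwa [norm_eq_abs, abs_of_nonneg (by positivity)]
  rw [IntegrableOn, volume_restrict_strip]
  rw [volume_restrict_strip] at hcs1 hcs2 hE
  refine ⟨hint, (integral_mono_ae hint hCA hle).trans ?_⟩
  rw [integral_const_mul, integral_prod_mul, hC, hA,
    ← integral_prod (fun p : ℝ × ℝ => |exp (2 * b * p.1) * (f p.1 p.2 * fy p.1 p.2)|) hhi,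
    ← integral_prod_symm (fun p : ℝ × ℝ =>
      |exp (2 * b * p.1) * (f p.1 p.2 * (fx p.1 p.2 + b * f p.1 p.2))|) hgi]
  nlinarith [sq_nonneg ((∫ p, |exp (2 * b * p.1) * (f p.1 p.2 * fy p.1 p.2)|
      ∂((volume : Measure ℝ).prod (volume.restrict (Ioo 0 B))))
    - ∫ p, |exp (2 * b * p.1) * (f p.1 p.2 * (fx p.1 p.2 + b * f p.1 p.2))|
      ∂((volume : Measure ℝ).prod (volume.restrict (Ioo 0 B))))]

/-- The weighted inner product `∫_S e^{2cx} f g`. -/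
noncomputable def wip (B c : ℝ) (f g : ℝ → ℝ → ℝ) : ℝ :=
  ∫ p in strip B, exp (2 * c * p.1) * (f p.1 p.2 * g p.1 p.2)

/-- The weighted trilinear form `∫_S e^{2cx} f g h`. -/
noncomputable def wtri (B c : ℝ) (f g h : ℝ → ℝ → ℝ) : ℝ :=
  ∫ p in strip B, exp (2 * c * p.1) * (f p.1 p.2 * g p.1 p.2) * h p.1 p.2

theorem wip_self (B c : ℝ) (f : ℝ → ℝ → ℝ) :
    wip B c f f = ∫ p in strip B, exp (2 * c * p.1) * f p.1 p.2 ^ 2 := by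
  simp only [wip, sq]

theorem wip_self_nonneg (B c : ℝ) (f : ℝ → ℝ → ℝ) : 0 ≤ wip B c f f := by
  rw [wip_self]
  exact integral_nonneg fun p => by positivity

theorem wip_comm (B c : ℝ) (f g : ℝ → ℝ → ℝ) : wip B c f g = wip B c g f := by
  simp only [wip, mul_comm (f _ _)]

theorem wip_parts_x {B b c : ℝ} (hc : 0 ≤ c) (hcb : c ≤ b) {f g f' g' : ℝ → ℝ → ℝ}
    (hf : DecaysOnStrip B b f) (hg : DecaysOnStrip B b g) (hf' : DecaysOnStrip B b f')
    (hg' : DecaysOnStrip B b g') (hdf : ∀ x y, HasDerivAt (fun x' => f x' y) (f' x y) x)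
    (hdg : ∀ x y, HasDerivAt (fun x' => g x' y) (g' x y) x) :
    2 * c * wip B c f g + wip B c f' g + wip B c f g' = 0 := by
  have i1 := (hf.integrableOn_mul hg hc hcb).const_mul (2 * c)
  have i2 := hf'.integrableOn_mul hg hc hcb
  have i3 := hf.integrableOn_mul hg' hc hcb
  have h := integral_strip_deriv_x_eq_zero (B := B)
    (P := fun x y => exp (2 * c * x) * (f x y * g x y))
    (P' := fun x y => 2 * c * (exp (2 * c * x) * (f x y * g x y))
      + exp (2 * c * x) * (f' x y * g x y) + exp (2 * c * x) * (f x y * g' x y))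
    (fun x y => ((hasDerivAt_exp_weight c x).mul ((hdf x y).mul (hdg x y))).congr_deriv
      (by simp only [Pi.mul_apply]; ring))
    ((i1.add i2).add i3) (fun y hy => hf.tendsto_mul hg hc hcb hy)
  rwa [integral_add (i1.fun_add i2) i3, integral_add i1 i2, integral_const_mul] at h

theorem wip_parts_y {B b c : ℝ} (hB : 0 < B) (hc : 0 ≤ c) (hcb : c ≤ b) {f g f' g' : ℝ → ℝ → ℝ}
    (hf : DecaysOnStrip B b f) (hg : DecaysOnStrip B b g) (hf' : DecaysOnStrip B b f')
    (hg' : DecaysOnStrip B b g') (hdf : ∀ x y, HasDerivAt (fun y' => f x y') (f' x y) y)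
    (hdg : ∀ x y, HasDerivAt (fun y' => g x y') (g' x y) y)
    (h0 : ∀ x, f x 0 = 0) (hfB : ∀ x, f x B = 0) :
    wip B c f' g + wip B c f g' = 0 := by
  have i2 := hf'.integrableOn_mul hg hc hcb
  have i3 := hf.integrableOn_mul hg' hc hcb
  have c1 := hf.cont
  have c2 := hg.cont
  have c3 := hf'.cont
  have c4 := hg'.cont
  have h := integral_strip_deriv_y_eq_zero hB
    (Q := fun x y => exp (2 * c * x) * (f x y * g x y))
    (Q' := fun x y => exp (2 * c * x) * (f' x y * g x y) + exp (2 * c * x) * (f x y * g' x y))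
    (fun x y => (((hdf x y).mul (hdg x y)).const_mul _).congr_deriv (by ring))
    (by fun_prop) (i2.add i3) (fun x => by simp [h0]) (fun x => by simp [hfB])
  rwa [integral_add i2 i3] at h

theorem wtri_parts_x {B b c : ℝ} (hc : 0 ≤ c) (hcb : c ≤ b) {f f' : ℝ → ℝ → ℝ}
    (hf : DecaysOnStrip B b f) (hf' : DecaysOnStrip B b f')
    (hdf : ∀ x y, HasDerivAt (fun x' => f x' y) (f' x y) x) :
    2 * c * wtri B c f f f + 3 * wtri B c f f f' = 0 := by
  have i1 := (hf.integrableOn_mul_mul hf hf hc hcb).const_mul (2 * c)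
  have i2 := (hf.integrableOn_mul_mul hf hf' hc hcb).const_mul 3
  have h := integral_strip_deriv_x_eq_zero (B := B)
    (P := fun x y => exp (2 * c * x) * (f x y * f x y) * f x y)
    (P' := fun x y => 2 * c * (exp (2 * c * x) * (f x y * f x y) * f x y)
      + 3 * (exp (2 * c * x) * (f x y * f x y) * f' x y))
    (fun x y => (((hasDerivAt_exp_weight c x).mul ((hdf x y).mul (hdf x y))).mul
      (hdf x y)).congr_deriv (by simp only [Pi.mul_apply]; ring))
    (i1.add i2) (fun y hy => hf.tendsto_mul_mul hf hf hc hcb hy)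
  rwa [integral_add i1 i2, integral_const_mul, integral_const_mul] at h

theorem cubic_estimate {B b : ℝ} (hb : 0 ≤ b) {f fx fy : ℝ → ℝ → ℝ}
    (hf : DecaysOnStrip B b f) (hfx : DecaysOnStrip B b fx) (hfy : DecaysOnStrip B b fy)
    (hdx : ∀ x y, HasDerivAt (fun x' => f x' y) (fx x y) x)
    (hdy : ∀ x y, HasDerivAt (fun y' => f x y') (fy x y) y) (h0 : ∀ x, f x 0 = 0) :
    4 / 3 * wtri B b f f f ≤ 16 / 9 * wip B 0 f f * wip B b f f
      + wip B b fx fx + b ^ 2 * wip B b f f + 1 / 2 * wip B b fy fy := by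
  obtain ⟨hL, hL2⟩ := ladyzhenskaya_strip hb hf hfx hfy hdx hdy h0
  have hX : ∫ p in strip B, exp (2 * b * p.1) * (fx p.1 p.2 + b * f p.1 p.2) ^ 2
      ≤ 2 * wip B b fx fx + 2 * b ^ 2 * wip B b f f := by
    have i1 := (hfx.integrableOn_sq hb le_rfl).const_mul 2
    have i2 := (hf.integrableOn_sq hb le_rfl).const_mul (2 * b ^ 2)
    rw [wip_self, wip_self, ← integral_const_mul, ← integral_const_mul, ← integral_add i1 i2]
    refine integral_mono ((hfx.add (hf.const_mul b)).integrableOn_sq hb le_rfl) (i1.add i2)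
      fun p => ?_
    have := mul_nonneg (exp_pos (2 * b * p.1)).le (sq_nonneg (fx p.1 p.2 - b * f p.1 p.2))
    linarith
  rw [← wip_self, ← wip_self] at hL2
  rcases (wip_self_nonneg B b f).eq_or_lt with hE | hE
  · have hz : wtri B b f f f = 0 := by
      have h := hE.symm
      rw [wip, integral_eq_zero_iff_of_nonneg
        (fun p => mul_nonneg (exp_pos _).le (mul_self_nonneg _))
        (hf.integrableOn_mul hf hb le_rfl)] at h
      refine integral_eq_zero_of_ae ?_
      filter_upwards [h] with p hp
      simp only [Pi.zero_apply] at hp ⊢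
      rw [hp, zero_mul]
    have h1 := wip_self_nonneg B b fx
    have h2 := wip_self_nonneg B b fy
    rw [hz, ← hE]
    linarith
  · set E := wip B b f f with hEdef
    have i1 : IntegrableOn (fun p : ℝ × ℝ => 4 * E / 3 * f p.1 p.2 ^ 2) (strip B) := by
      rw [IntegrableOn]
      simpa using (hf.integrableOn_sq (c := 0) le_rfl hb).const_mul (4 * E / 3)
    have i2 := hL.const_mul (3 / (16 * E))
    have h1 : wtri B b f f f ≤ 4 * E / 3 * wip B 0 f f + 3 / (16 * E) *
        ∫ p in strip B, (exp (2 * b * p.1) * f p.1 p.2 ^ 2) ^ 2 := by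
      have e0 : wip B 0 f f = ∫ p in strip B, f p.1 p.2 ^ 2 := by simp [wip_self]
      rw [e0, ← integral_const_mul, ← integral_const_mul, ← integral_add i1 i2]
      refine integral_mono (hf.integrableOn_mul_mul hf hf hb le_rfl) (i1.add i2) fun p => ?_
      have : 4 * E / 3 * f p.1 p.2 ^ 2
          + 3 / (16 * E) * (exp (2 * b * p.1) * f p.1 p.2 ^ 2) ^ 2
          - exp (2 * b * p.1) * (f p.1 p.2 * f p.1 p.2) * f p.1 p.2
          = 3 / (16 * E) * (8 * E / 3 * f p.1 p.2 - exp (2 * b * p.1) * f p.1 p.2 ^ 2) ^ 2 := by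
        field_simp
        ring
      have h3 : 0 ≤ 3 / (16 * E) * (8 * E / 3 * f p.1 p.2
        - exp (2 * b * p.1) * f p.1 p.2 ^ 2) ^ 2 := by positivity
      linarith
    have h2 := mul_le_mul_of_nonneg_left hL2 (by positivity : 0 ≤ 3 / (16 * E))
    have h3 : ∀ X Y : ℝ, 3 / (16 * E) * (2 * E * (X + Y)) = 3 / 8 * (X + Y) := fun X Y => by
      field_simp
      ring
    rw [h3] at h2
    linarith

/-! ### The energy identity and its integration in time -/

theorem pd_zero (u : ℝ → ℝ → ℝ → ℝ) (x y t : ℝ) : pd 0 0 0 u x y t = u x y t := by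
  simp [pd]

namespace IsZKBSolution

variable {B b c : ℝ} {u : ℝ → ℝ → ℝ → ℝ}

theorem energy_identity (hu : IsZKBSolution B b u) (hB : 0 < B) (hc : 0 ≤ c) (hcb : c ≤ b)
    {t : ℝ} (ht : 0 < t) :
    2 * wip B c (fun x y => pd 0 0 0 u x y t) (fun x y => pd 0 0 1 u x y t)
      = -(2 + 6 * c) * wip B c (fun x y => pd 1 0 0 u x y t) (fun x y => pd 1 0 0 u x y t)
        - 2 * c * wip B c (fun x y => pd 0 1 0 u x y t) (fun x y => pd 0 1 0 u x y t)
        + (4 * c ^ 2 + 8 * c ^ 3)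
          * wip B c (fun x y => pd 0 0 0 u x y t) (fun x y => pd 0 0 0 u x y t)
        + 4 * c / 3 * wtri B c (fun x y => pd 0 0 0 u x y t) (fun x y => pd 0 0 0 u x y t)
          (fun x y => pd 0 0 0 u x y t) := by
  have D : ∀ i j k : ℕ, i + j + k ≤ 5 → DecaysOnStrip B b (fun x y => pd i j k u x y t) :=
    fun i j k h => hu.decaysOnStrip h ht.le
  have dx : ∀ i j k : ℕ, ∀ x y, HasDerivAt (fun x' => pd i j k u x' y t)
      (pd (i + 1) j k u x y t) x := fun i j k x y => hasDerivAt_pd_x hu.smooth i j k x y t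
  have D0 := D 0 0 0 (by norm_num)
  have Dx := D 1 0 0 (by norm_num)
  have Dxx := D 2 0 0 (by norm_num)
  have Dxxx := D 3 0 0 (by norm_num)
  have Dy := D 0 1 0 (by norm_num)
  have Dxy := D 1 1 0 (by norm_num)
  have Dxyy := D 1 2 0 (by norm_num)
  have p1 := wip_parts_x hc hcb D0 Dx Dx Dxx (dx 0 0 0) (dx 1 0 0)
  have p2 := wip_parts_x hc hcb D0 D0 Dx Dx (dx 0 0 0) (dx 0 0 0)
  have p3 := wip_parts_x hc hcb D0 Dxx Dx Dxxx (dx 0 0 0) (dx 2 0 0)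
  have p4 := wip_parts_x hc hcb Dx Dx Dxx Dxx (dx 1 0 0) (dx 1 0 0)
  have p5 := wip_parts_x hc hcb Dy Dy Dxy Dxy (dx 0 1 0) (dx 0 1 0)
  have p6 := wip_parts_y hB hc hcb D0 Dxy Dy Dxyy
    (fun x y => hasDerivAt_pd_y hu.smooth 0 0 x y t)
    (fun x y => hasDerivAt_pd_one_y hu.smooth 1 0 x y t)
    (fun x => by rw [pd_zero]; exact hu.bdry0 x t ht.le)
    (fun x => by rw [pd_zero]; exact hu.bdryB x t ht.le)
  have p7 := wtri_parts_x hc hcb D0 Dx (dx 0 0 0)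
  have i1 := D0.integrableOn_mul Dxx hc hcb
  have i2 := D0.integrableOn_mul_mul D0 Dx hc hcb
  have i3 := D0.integrableOn_mul Dxxx hc hcb
  have i4 := D0.integrableOn_mul Dxyy hc hcb
  have hpde : wip B c (fun x y => pd 0 0 0 u x y t) (fun x y => pd 0 0 1 u x y t)
      = wip B c (fun x y => pd 0 0 0 u x y t) (fun x y => pd 2 0 0 u x y t)
        - wtri B c (fun x y => pd 0 0 0 u x y t) (fun x y => pd 0 0 0 u x y t)
          (fun x y => pd 1 0 0 u x y t)
        - wip B c (fun x y => pd 0 0 0 u x y t) (fun x y => pd 3 0 0 u x y t)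
        - wip B c (fun x y => pd 0 0 0 u x y t) (fun x y => pd 1 2 0 u x y t) := by
    simp only [wip, wtri]
    rw [← integral_sub i1 i2, ← integral_sub (i1.fun_sub i2) i3,
      ← integral_sub ((i1.fun_sub i2).fun_sub i3) i4]
    refine setIntegral_congr_fun (measurableSet_strip B) fun p hp => ?_
    have h := hu.pde p.1 p.2 hp.2 t ht
    rw [← pd_zero u] at h
    linear_combination exp (2 * c * p.1) * pd 0 0 0 u p.1 p.2 t * h
  rw [wip_comm B c (fun x y => pd 2 0 0 u x y t) (fun x y => pd 1 0 0 u x y t)] at p4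
  rw [wip_comm B c (fun x y => pd 1 0 0 u x y t) (fun x y => pd 0 0 0 u x y t)] at p2
  rw [wip_comm B c (fun x y => pd 1 1 0 u x y t) (fun x y => pd 0 1 0 u x y t)] at p5
  rw [hpde]
  linear_combination (2 + 4 * c) * p1 - (2 * c + 4 * c ^ 2) * p2 - 2 * p3 + p4 + p5 - 2 * p6
    - 2 / 3 * p7

theorem exp_mul_wip_le (hu : IsZKBSolution B b u) (hc : 0 ≤ c) (hcb : c ≤ b) (κ : ℝ) {T : ℝ}
    (hT : 0 ≤ T)
    (h : ∀ t, 0 < t → t ≤ T →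
      κ * wip B c (fun x y => pd 0 0 0 u x y t) (fun x y => pd 0 0 0 u x y t)
        + 2 * wip B c (fun x y => pd 0 0 0 u x y t) (fun x y => pd 0 0 1 u x y t) ≤ 0) :
    exp (κ * T) * wip B c (fun x y => pd 0 0 0 u x y T) (fun x y => pd 0 0 0 u x y T)
      ≤ wip B c (fun x y => pd 0 0 0 u x y 0) (fun x y => pd 0 0 0 u x y 0) := by
  set F : ℝ × ℝ → ℝ → ℝ := fun p s => exp (κ * s) *
    (κ * (exp (2 * c * p.1) * (pd 0 0 0 u p.1 p.2 s * pd 0 0 0 u p.1 p.2 s))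
      + 2 * (exp (2 * c * p.1) * (pd 0 0 0 u p.1 p.2 s * pd 0 0 1 u p.1 p.2 s))) with hF
  have c0 : Continuous (fun q : (ℝ × ℝ) × ℝ => pd 0 0 0 u q.1.1 q.1.2 q.2) :=
    (contDiff_pd hu.smooth 0 0 0).continuous.comp
      (f := fun q : (ℝ × ℝ) × ℝ => (q.1.1, q.1.2, q.2)) (by fun_prop)
  have c1 : Continuous (fun q : (ℝ × ℝ) × ℝ => pd 0 0 1 u q.1.1 q.1.2 q.2) :=
    (contDiff_pd hu.smooth 0 0 1).continuous.comp
      (f := fun q : (ℝ × ℝ) × ℝ => (q.1.1, q.1.2, q.2)) (by fun_prop)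
  have hFc : Continuous (Function.uncurry F) := by
    simp only [hF, Function.uncurry_def]
    fun_prop
  have hi0 : ∀ s, 0 ≤ s → IntegrableOn (fun p : ℝ × ℝ =>
      exp (2 * c * p.1) * (pd 0 0 0 u p.1 p.2 s * pd 0 0 0 u p.1 p.2 s)) (strip B) := fun s hs =>
    (hu.decaysOnStrip (by norm_num) hs).integrableOn_mul (hu.decaysOnStrip (by norm_num) hs) hc hcb
  have hi1 : ∀ s, 0 ≤ s → IntegrableOn (fun p : ℝ × ℝ =>
      exp (2 * c * p.1) * (pd 0 0 0 u p.1 p.2 s * pd 0 0 1 u p.1 p.2 s)) (strip B) := fun s hs =>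
    (hu.decaysOnStrip (by norm_num) hs).integrableOn_mul (hu.decaysOnStrip (by norm_num) hs) hc hcb
  have hFi : ∀ s, 0 ≤ s → IntegrableOn (fun p => F p s) (strip B) := fun s hs =>
    (((hi0 s hs).const_mul κ).add ((hi1 s hs).const_mul 2)).const_mul _
  have hFint : Integrable (Function.uncurry F)
      ((volume.restrict (strip B)).prod (volume.restrict (Ioc 0 T))) := by
    rw [integrable_prod_iff' hFc.aestronglyMeasurable]
    constructor
    · filter_upwards [ae_restrict_mem measurableSet_Ioc] with s hs
      exact hFi s hs.1.le
    · obtain ⟨M0, hM0⟩ := hu.bdd 0 0 0 (by norm_num) T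
      obtain ⟨M1, hM1⟩ := hu.bdd 0 0 1 (by norm_num) T
      refine Integrable.mono' (g := fun _ => exp (|κ| * T) * ((2 * |κ| + 2) * M0 + 2 * M1))
        (integrable_const _)
        (hFc.norm.aestronglyMeasurable (μ := (volume.restrict (strip B)).prod
          (volume.restrict (Ioc 0 T)))).prod_swap.integral_prod_right' ?_
      filter_upwards [ae_restrict_mem measurableSet_Ioc] with s hs
      have j0 := hu.integ 0 0 0 (by norm_num) s hs.1.le
      have j1 := hu.integ 0 0 1 (by norm_num) s hs.1.le
      rw [norm_of_nonneg (integral_nonneg fun p => norm_nonneg _)]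
      have hb0 := hM0 s ⟨hs.1.le, hs.2⟩
      have hb1 := hM1 s ⟨hs.1.le, hs.2⟩
      have hj := ((j0.const_mul (2 * |κ| + 2)).add (j1.const_mul 2)).const_mul (exp (|κ| * T))
      calc ∫ p in strip B, ‖F p s‖
          ≤ ∫ p in strip B, exp (|κ| * T) *
            ((2 * |κ| + 2) * ((1 + exp (2 * b * p.1)) * pd 0 0 0 u p.1 p.2 s ^ 2)
              + 2 * ((1 + exp (2 * b * p.1)) * pd 0 0 1 u p.1 p.2 s ^ 2)) := by
            refine integral_mono (hFi s hs.1.le).norm hj fun p => ?_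
            simp only [hF, norm_mul, norm_eq_abs, abs_exp]
            have e1 : exp (κ * s) ≤ exp (|κ| * T) := exp_le_exp.2
              (mul_le_mul (le_abs_self κ) hs.2 hs.1.le (abs_nonneg κ))
            refine mul_le_mul e1 ?_ (abs_nonneg _) (exp_pos _).le
            refine (abs_add_le _ _).trans ?_
            rw [abs_mul κ, abs_mul 2, abs_two]
            have a0 := abs_exp_mul_mul_le hc hcb p.1 (pd 0 0 0 u p.1 p.2 s) (pd 0 0 0 u p.1 p.2 s)
            have a1 := abs_exp_mul_mul_le hc hcb p.1 (pd 0 0 0 u p.1 p.2 s) (pd 0 0 1 u p.1 p.2 s)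
            have := mul_le_mul_of_nonneg_left a0 (abs_nonneg κ)
            linarith
        _ = exp (|κ| * T) *
            ((2 * |κ| + 2) * (∫ p in strip B, (1 + exp (2 * b * p.1)) * pd 0 0 0 u p.1 p.2 s ^ 2)
              + 2 * ∫ p in strip B, (1 + exp (2 * b * p.1)) * pd 0 0 1 u p.1 p.2 s ^ 2) := by
            rw [integral_const_mul, integral_add (j0.const_mul _) (j1.const_mul _),
              integral_const_mul, integral_const_mul]
        _ ≤ _ := by gcongr
  have hswap := integral_integral_swap hFint
  have hleft : ∫ p in strip B, ∫ s in Ioc 0 T, F p s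
      = exp (κ * T) * wip B c (fun x y => pd 0 0 0 u x y T) (fun x y => pd 0 0 0 u x y T)
        - wip B c (fun x y => pd 0 0 0 u x y 0) (fun x y => pd 0 0 0 u x y 0) := by
    rw [wip, wip, ← integral_const_mul,
      ← integral_sub ((hi0 T hT).const_mul _) (hi0 0 le_rfl)]
    refine integral_congr_ae (Eventually.of_forall fun p => ?_)
    have hFp : Continuous (F p) := hFc.comp (f := fun s : ℝ => (p, s)) (by fun_prop)
    have hd : ∀ s, HasDerivAt (fun s => exp (κ * s) *
        (exp (2 * c * p.1) * (pd 0 0 0 u p.1 p.2 s * pd 0 0 0 u p.1 p.2 s))) (F p s) s := by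
      intro s
      have h1 := hasDerivAt_pd_t hu.smooth 0 p.1 p.2 s
      have h2 : HasDerivAt (fun s => exp (κ * s)) (exp (κ * s) * κ) s := by
        simpa using ((hasDerivAt_id s).const_mul κ).exp
      exact (h2.mul ((h1.mul h1).const_mul _)).congr_deriv
        (by simp only [hF, Pi.mul_apply, zero_add]; ring)
    have := intervalIntegral.integral_eq_sub_of_hasDerivAt (a := 0) (b := T)
      (fun s _ => hd s) (hFp.intervalIntegrable 0 T)
    rw [intervalIntegral.integral_of_le hT] at this
    simpa using this
  have hright : ∫ s in Ioc 0 T, ∫ p in strip B, F p s ≤ 0 := by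
    refine setIntegral_nonpos measurableSet_Ioc fun s hs => ?_
    rw [hF, integral_const_mul, integral_add ((hi0 s hs.1.le).const_mul κ)
      ((hi1 s hs.1.le).const_mul 2), integral_const_mul, integral_const_mul]
    exact mul_nonpos_of_nonneg_of_nonpos (exp_pos _).le (h s hs.1 hs.2)
  linarith

theorem wip_zero_le (hu : IsZKBSolution B b u) (hB : 0 < B) (hb : 0 ≤ b) {t : ℝ} (ht : 0 ≤ t) :
    wip B 0 (fun x y => pd 0 0 0 u x y t) (fun x y => pd 0 0 0 u x y t)
      ≤ wip B 0 (fun x y => pd 0 0 0 u x y 0) (fun x y => pd 0 0 0 u x y 0) := by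
  have h := hu.exp_mul_wip_le le_rfl hb 0 ht fun s hs _ => by
    rw [hu.energy_identity hB le_rfl hb hs]
    have := wip_self_nonneg B 0 (fun x y => pd 1 0 0 u x y s)
    linarith
  simpa using h

end IsZKBSolution

/-- **Differential decay inequality** ((4.4)–(4.5) of the paper): for a classical
solution `u` with decay weight `b` of the ZKB problem on the strip `S`, setting
`χ = b[π²/B² − 4b − 10b² − (16/9)‖u₀‖²]`, one has for every `t ≥ 0`
`∫_S e^{2bx} u(t)² ≤ e^{−χt} ∫_S e^{2bx} u₀²`. -/
theorem zkb_decay_inequality (B b χ : ℝ) (hB : 0 < B) (hb : 0 < b)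
    (u : ℝ → ℝ → ℝ → ℝ) (hu : IsZKBSolution B b u)
    (hχ : χ = b * (π^2/B^2 - 4*b - 10*b^2
      - (16/9) * (∫ p in strip B, (u p.1 p.2 0)^2))) :
    ∀ t : ℝ, 0 ≤ t →
      (∫ p in strip B, Real.exp (2*b*p.1) * (u p.1 p.2 t)^2)
        ≤ Real.exp (-χ*t) * ∫ p in strip B, Real.exp (2*b*p.1) * (u p.1 p.2 0)^2 := by
  intro t ht
  have h := hu.exp_mul_wip_le hb.le le_rfl χ ht fun s hs _ => by
    have D0 := hu.decaysOnStrip (i := 0) (j := 0) (k := 0) (by norm_num) hs.le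
    have Dx := hu.decaysOnStrip (i := 1) (j := 0) (k := 0) (by norm_num) hs.le
    have Dy := hu.decaysOnStrip (i := 0) (j := 1) (k := 0) (by norm_num) hs.le
    have b0 : ∀ x, pd 0 0 0 u x 0 s = 0 := fun x => by rw [pd_zero]; exact hu.bdry0 x s hs.le
    have bB : ∀ x, pd 0 0 0 u x B s = 0 := fun x => by rw [pd_zero]; exact hu.bdryB x s hs.le
    have hdy := fun x y => hasDerivAt_pd_y hu.smooth 0 0 x y s
    have hcub := cubic_estimate hb.le D0 Dx Dy (fun x y => hasDerivAt_pd_x hu.smooth 0 0 0 x y s)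
      hdy b0
    have hst := steklov_strip hB hb.le le_rfl D0 Dy hdy b0 bB
    rw [← wip_self B b (fun x y => pd 0 0 0 u x y s),
      ← wip_self B b (fun x y => pd 0 1 0 u x y s)] at hst
    have hN := hu.wip_zero_le hB hb.le hs.le
    have e0 : wip B 0 (fun x y => pd 0 0 0 u x y 0) (fun x y => pd 0 0 0 u x y 0)
        = ∫ p in strip B, (u p.1 p.2 0) ^ 2 := by simp [wip_self, pd_zero]
    rw [e0] at hN
    rw [hu.energy_identity hB hb.le le_rfl hs, hχ]
    have hE := wip_self_nonneg B b (fun x y => pd 0 0 0 u x y s)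
    have hX := wip_self_nonneg B b (fun x y => pd 1 0 0 u x y s)
    have hY := wip_self_nonneg B b (fun x y => pd 0 1 0 u x y s)
    have h1 := mul_le_mul_of_nonneg_left hcub hb.le
    have h2 := mul_le_mul_of_nonneg_left hst hb.le
    have h3 := mul_le_mul_of_nonneg_left (mul_le_mul_of_nonneg_right hN hE) hb.le
    have h4 := mul_nonneg hb.le hX
    have h5 := mul_nonneg hb.le hY
    have h6 : 0 ≤ b ^ 3 * wip B b (fun x y => pd 0 0 0 u x y s) (fun x y => pd 0 0 0 u x y s) :=
      mul_nonneg (by positivity) hE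
    linarith
  simp only [wip_self, pd_zero] at h
  have h2 := mul_le_mul_of_nonneg_left h (exp_pos (-χ * t)).le
  rwa [← mul_assoc, ← exp_add, neg_mul, neg_add_cancel, exp_zero, one_mul, ← neg_mul] at h2
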